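/- Let G = (V,E) be a finite directed graph, d ≥ 0 an integer, and P = ⟨v_0,…,v_ℓ⟩ a path in G. Write u ⪯_d v if there is a directed path from u to v in G with at most d arcs. Let A be the set of d-limited ancestors of P: vertices u with u ⪯_d v_i for some index i and v_j ⋠_d u for every index j. For u ∈ A let a(u) be the least index with u ⪯_d v_{a(u)}; let V_S(u) = { w ∈ V : u ⪯_d w and w ⋠_d u } and V_R(u) = { w ∈ V : u ⋠_d w and w ⋠_d u }. For u, v ∈ A, say that u preserves v if either (i) v ∈ V_R(u) and, in the induced subgraph G[V_R(u)], v can reach within d arcs some vertex v_i with i < a(u) but no vertex v_i with i < a(u) can reach v within d arcs; or (ii) v ∈ V_S(u) and, in the induced subgraph G[V_S(u)], v can reach within d arcs some vertex v_i with i ≥ a(u) but no vertex v_i with i ≥ a(u) can reach v within d arcs. Then the preserves relation is irreflexive and antisymmetric on A, and consequently Σ_{u∈A} |{ v ∈ A : u preserves v }| ≤ |A|·(|A|−1)/2. -/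

import Mathlib

/-- `ReachLen E k u v`: there is a directed path from `u` to `v` with exactly `k` arcs. -/
def ReachLen {V : Type*} (E : V → V → Prop) : ℕ → V → V → Prop
  | 0, u, v => u = v
  | n + 1, u, v => ∃ w, E u w ∧ ReachLen E n w v

/-- `ReachWithin E d u v` (`u ⪯_d v`): there is a directed path from `u` to `v`
consisting of at most `d` arcs. -/
def ReachWithin {V : Type*} (E : V → V → Prop) (d : ℕ) (u v : V) : Prop :=
  ∃ k ≤ d, ReachLen E k u v

/-- `ReachWithinIn E U d u v`: there is a directed path from `u` to `v` of at most
`d` arcs using only arcs between vertices of the set `U` (the induced subgraph `G[U]`). -/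
def ReachWithinIn {V : Type*} (E : V → V → Prop) (U : Set V) (d : ℕ) (u v : V) : Prop :=
  ReachWithin (fun a b => a ∈ U ∧ b ∈ U ∧ E a b) d u v

theorem ReachLen.mono {V : Type*} {E F : V → V → Prop} (h : ∀ a b, E a b → F a b) :
    ∀ {k : ℕ} {u v : V}, ReachLen E k u v → ReachLen F k u v
  | 0, _, _, huv => huv
  | _ + 1, _, _, ⟨w, huw, hwv⟩ => ⟨w, h _ _ huw, hwv.mono h⟩

theorem ReachWithinIn.reachWithin {V : Type*} {E : V → V → Prop} {U : Set V} {d : ℕ} {u v : V}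
    (h : ReachWithinIn E U d u v) : ReachWithin E d u v :=
  let ⟨k, hk, hr⟩ := h
  ⟨k, hk, hr.mono fun _ _ hab => hab.2.2⟩

open Finset in
/-- An asymmetric relation on a finite set of size `n` relates at most `n * (n - 1) / 2`
ordered pairs. -/
theorem Finset.sum_card_filter_le_of_asymm {V : Type*} (s : Finset V) (r : V → V → Prop)
    [DecidableRel r] (h : ∀ u ∈ s, ∀ w ∈ s, r u w → ¬ r w u) :
    ∑ u ∈ s, #{w ∈ s | r u w} ≤ #s * (#s - 1) / 2 := by
  classical
  have hcomm : ∑ u ∈ s, #{w ∈ s | r u w} = ∑ u ∈ s, #{w ∈ s | r w u} := by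
    simp only [card_filter]
    exact sum_comm
  have hle : ∑ u ∈ s, (#{w ∈ s | r u w} + #{w ∈ s | r w u}) ≤ ∑ _u ∈ s, (#s - 1) := by
    refine sum_le_sum fun u hu => ?_
    rw [← card_union_of_disjoint, ← card_erase_of_mem hu]
    · refine card_le_card fun w hw => ?_
      simp only [mem_union, mem_filter, mem_erase] at hw ⊢
      refine ⟨?_, hw.elim And.left And.left⟩
      rintro rfl
      rcases hw with hw | hw <;> exact h w hu w hu hw.2 hw.2
    · rw [disjoint_filter]
      exact fun w hw huw => h u hu w hw huw
  rw [sum_add_distrib, ← hcomm, sum_const, smul_eq_mul] at hle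
  omega

/-- The core of the paper's Lemma 4.6 (the distance-limited asymmetry lemma): the
`preserves` relation, defined with respect to distance-`d` core searches from the pivot,
is irreflexive and antisymmetric on the set `A` of `d`-limited ancestors of the path,
and consequently `Σ_{u∈A} |{ w ∈ A : u preserves w }| ≤ |A|·(|A|−1)/2`. -/
theorem preserves_antisymmetric_distance_limited {V : Type*} [Fintype V] [DecidableEq V]
    (E : V → V → Prop) (d : ℕ)
    (ℓ : ℕ) (pv : ℕ → V) (hpath : ∀ i < ℓ, E (pv i) (pv (i + 1)))
    (A : Set V)
    (hA : ∀ u, u ∈ A ↔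
      ((∃ i ≤ ℓ, ReachWithin E d u (pv i)) ∧ ∀ j ≤ ℓ, ¬ ReachWithin E d (pv j) u))
    (a : V → ℕ)
    (ha : ∀ u ∈ A, a u ≤ ℓ ∧ ReachWithin E d u (pv (a u)) ∧
      ∀ i < a u, ¬ ReachWithin E d u (pv i))
    (VS VR : V → Set V)
    (hVS : ∀ u, VS u = {w | ReachWithin E d u w ∧ ¬ ReachWithin E d w u})
    (hVR : ∀ u, VR u = {w | ¬ ReachWithin E d u w ∧ ¬ ReachWithin E d w u})
    (preserves : V → V → Prop)
    (hpres : ∀ u w, preserves u w ↔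
      ((w ∈ VR u ∧
          (∃ i < a u, ReachWithinIn E (VR u) d w (pv i)) ∧
          ∀ i < a u, ¬ ReachWithinIn E (VR u) d (pv i) w) ∨
       (w ∈ VS u ∧
          (∃ i, a u ≤ i ∧ i ≤ ℓ ∧ ReachWithinIn E (VS u) d w (pv i)) ∧
          ∀ i, a u ≤ i → i ≤ ℓ → ¬ ReachWithinIn E (VS u) d (pv i) w))) :
    (∀ u ∈ A, ¬ preserves u u) ∧
    (∀ u ∈ A, ∀ w ∈ A, preserves u w → ¬ preserves w u) ∧
    ∑ u ∈ (Set.toFinite A).toFinset, Set.ncard {w ∈ A | preserves u w} ≤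
      A.ncard * (A.ncard - 1) / 2 := by
  have hasymm : ∀ u ∈ A, ∀ w ∈ A, preserves u w → ¬ preserves w u := by
    intro u hu w hw huw hwu
    rw [hpres, hVR, hVS] at huw hwu
    rcases huw with ⟨huw, ⟨i, hi, hwi⟩, -⟩ | ⟨huw, -⟩
    · rcases hwu with ⟨-, ⟨j, hj, huj⟩, -⟩ | ⟨hwu, -⟩
      · have hai : a w ≤ i := not_lt.1 fun hlt => (ha w hw).2.2 i hlt hwi.reachWithin
        have haj : a u ≤ j := not_lt.1 fun hlt => (ha u hu).2.2 j hlt huj.reachWithin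
        omega
      · exact huw.2 hwu.1
    · rcases hwu with ⟨hwu, -⟩ | ⟨hwu, -⟩
      · exact hwu.2 huw.1
      · exact huw.2 hwu.1
  refine ⟨fun u hu huu => hasymm u hu u hu huu huu, hasymm, ?_⟩
  classical
  rw [Set.ncard_eq_toFinset_card A (Set.toFinite A)]
  refine le_of_eq_of_le (Finset.sum_congr rfl fun u _ => ?_)
    (Finset.sum_card_filter_le_of_asymm (Set.toFinite A).toFinset preserves
      (by simpa using hasymm))
  rw [← Set.ncard_coe_finset]
  congr 1
  ext w
  simp
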